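/- There exists a universal constant C > 0 such that for every finite subset X of a real inner product space and every set of terminals K ⊆ X with |K| = k ≥ 2, there exist a natural number m ≤ C·log k, a map F : X → ℝ^m, and a constant c > 0 such that for all v ∈ K and u ∈ X, ‖v−u‖ ≤ c·‖F(v)−F(u)‖₂ ≤ C·‖v−u‖, where ‖·‖₂ is the Euclidean norm on ℝ^m, ‖v−u‖ is the inner product space norm, and log denotes the natural logarithm. -/

import Mathlib

/-- The ℓ_p norm (for a real exponent `p`) of a vector in `ℝ^m`;
with `p = 2` this is the Euclidean norm. -/
noncomputable def lpNorm {m : ℕ} (p : ℝ) (x : Fin m → ℝ) : ℝ :=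
  (∑ i, |x i| ^ p) ^ (1 / p)

open ProbabilityTheory Real
open scoped RealInnerProductSpace

section Gaussian

open MeasureTheory

lemma stdGaussian_map_inner {E : Type*} [NormedAddCommGroup E] [InnerProductSpace ℝ E]
    [FiniteDimensional ℝ E] [MeasurableSpace E] [BorelSpace E] (x : E) (hx : ‖x‖ = 1) :
    (stdGaussian E).map (fun g => ⟪x, g⟫) = gaussianReal 0 1 := by
  have h := IsGaussian.map_eq_gaussianReal (μ := stdGaussian E) (innerSL ℝ x)
  rw [integral_strongDual_stdGaussian, variance_dual_stdGaussian, innerSL_apply_norm, hx] at h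
  simpa using h

lemma exp_mul_sq_mul_gaussianPDFReal (b y : ℝ) :
    gaussianPDFReal 0 1 y * exp (b * y ^ 2) =
      (√(2 * π))⁻¹ * exp (-(1 / 2 - b) * y ^ 2) := by
  rw [gaussianPDFReal_def]
  simp only [NNReal.coe_one, mul_one, sub_zero]
  rw [mul_assoc, ← exp_add]
  congr 2
  ring

lemma integral_exp_mul_sq_gaussianReal {b : ℝ} (hb : b < 1 / 2) :
    ∫ y, exp (b * y ^ 2) ∂(gaussianReal 0 1) = √(1 / (1 - 2 * b)) := by
  rw [integral_gaussianReal_eq_integral_smul one_ne_zero]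
  simp_rw [smul_eq_mul, exp_mul_sq_mul_gaussianPDFReal]
  rw [integral_const_mul, integral_gaussian, ← Real.sqrt_inv, ← Real.sqrt_mul (by positivity)]
  congr 1
  have h1 : 1 / 2 - b ≠ 0 := by linarith
  have h2 : 1 - 2 * b ≠ 0 := by linarith
  field_simp

lemma integrable_exp_mul_sq_gaussianReal {b : ℝ} (hb : b < 1 / 2) :
    Integrable (fun y => exp (b * y ^ 2)) (gaussianReal 0 1) := by
  refine Integrable.of_integral_ne_zero ?_
  rw [integral_exp_mul_sq_gaussianReal hb]
  have : 0 < 1 - 2 * b := by linarith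
  positivity

section Projection

variable {E : Type*} [NormedAddCommGroup E] [InnerProductSpace ℝ E]
    [FiniteDimensional ℝ E] [MeasurableSpace E] [BorelSpace E]

lemma integral_exp_mul_sum_inner_sq {b : ℝ} (hb : b < 1 / 2) {x : E} (hx : ‖x‖ = 1) (m : ℕ) :
    ∫ g : Fin m → E, exp (b * ∑ j, ⟪x, g j⟫ ^ 2) ∂(Measure.pi fun _ => stdGaussian E) =
      √(1 / (1 - 2 * b)) ^ m := by
  simp_rw [Finset.mul_sum, exp_sum]
  rw [integral_fintype_prod_eq_pow (f := fun y : E => exp (b * ⟪x, y⟫ ^ 2)), Fintype.card_fin,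
    ← integral_exp_mul_sq_gaussianReal hb, ← stdGaussian_map_inner x hx,
    integral_map (by fun_prop) (by fun_prop)]

lemma integrable_exp_mul_sum_inner_sq {b : ℝ} (hb : b < 1 / 2) {x : E} (hx : ‖x‖ = 1) (m : ℕ) :
    Integrable (fun g : Fin m → E => exp (b * ∑ j, ⟪x, g j⟫ ^ 2))
      (Measure.pi fun _ => stdGaussian E) := by
  refine Integrable.of_integral_ne_zero ?_
  rw [integral_exp_mul_sum_inner_sq hb hx]
  have : 0 < 1 - 2 * b := by linarith
  positivity

lemma exists_projection_of_norm_eq_one {ι : Type*} (T : Finset ι) (x : ι → E)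
    (hx : ∀ i ∈ T, ‖x i‖ = 1) (m : ℕ) (hm : 2 * T.card * exp (-m) < 1) :
    ∃ g : Fin m → E, ∀ i ∈ T,
      m / 40 ≤ ∑ j, ⟪x i, g j⟫ ^ 2 ∧ ∑ j, ⟪x i, g j⟫ ^ 2 ≤ 8 * m := by
  let Y : ι → (Fin m → E) → ℝ := fun i g => ∑ j, ⟪x i, g j⟫ ^ 2
  let h : ι → (Fin m → E) → ℝ := fun i g =>
    exp (-2 * m) * exp (1 / 4 * Y i g) + exp m * exp (-40 * Y i g)
  have hint : ∀ i ∈ T, Integrable (h i) (Measure.pi fun _ => stdGaussian E) := fun i hi =>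
    ((integrable_exp_mul_sum_inner_sq (by norm_num) (hx i hi) m).const_mul _).add
      ((integrable_exp_mul_sum_inner_sq (by norm_num) (hx i hi) m).const_mul _)
  have hle : ∀ i ∈ T, ∫ g, h i g ∂(Measure.pi fun _ => stdGaussian E) ≤ 2 * exp (-m) := by
    intro i hi
    rw [integral_add
      ((integrable_exp_mul_sum_inner_sq (by norm_num) (hx i hi) m).const_mul _)
      ((integrable_exp_mul_sum_inner_sq (by norm_num) (hx i hi) m).const_mul _),
      integral_const_mul, integral_const_mul,
      integral_exp_mul_sum_inner_sq (by norm_num) (hx i hi),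
      integral_exp_mul_sum_inner_sq (by norm_num) (hx i hi)]
    have e1 : √(1 / (1 - 2 * (1 / 4))) ≤ exp 1 := by
      rw [Real.sqrt_le_left (exp_pos _).le]
      nlinarith [Real.add_one_le_exp (1 : ℝ)]
    have e2 : √(1 / (1 - 2 * (-40))) ≤ exp (-2) := by
      have : (1 / (1 - 2 * (-40)) : ℝ) = (1 / 9) ^ 2 := by norm_num
      rw [this, Real.sqrt_sq (by norm_num), exp_neg, one_div]
      refine inv_anti₀ (exp_pos _) ?_
      have : exp 2 = exp 1 ^ 2 := by rw [← exp_nat_mul]; norm_num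
      rw [this]
      nlinarith [Real.exp_one_lt_d9, exp_pos 1]
    have p1 := pow_le_pow_left₀ (Real.sqrt_nonneg _) e1 m
    have p2 := pow_le_pow_left₀ (Real.sqrt_nonneg _) e2 m
    rw [← exp_nat_mul] at p1 p2
    calc _ ≤ exp (-2 * m) * exp (m * 1) + exp m * exp (m * (-2)) := by gcongr
      _ = 2 * exp (-m) := by
        rw [← exp_add, ← exp_add, two_mul]
        congr 2 <;> ring
  obtain ⟨g, hg⟩ := exists_le_integral (integrable_finsetSum T hint)
  refine ⟨g, fun i hi => ?_⟩
  have hlt : h i g < 1 := by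
    calc h i g ≤ ∑ i ∈ T, h i g :=
          Finset.single_le_sum (f := fun i => h i g) (fun _ _ => by positivity) hi
      _ ≤ _ := hg
      _ = ∑ i ∈ T, ∫ g, h i g ∂(Measure.pi fun _ => stdGaussian E) := integral_finsetSum T hint
      _ ≤ ∑ i ∈ T, 2 * exp (-m) := Finset.sum_le_sum hle
      _ = 2 * T.card * exp (-m) := by rw [Finset.sum_const, nsmul_eq_mul]; ring
      _ < 1 := hm
  simp only [h, ← exp_add] at hlt
  have l1 := exp_lt_one_iff.1 (lt_of_le_of_lt (le_add_of_nonneg_right (exp_pos _).le) hlt)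
  have l2 := exp_lt_one_iff.1 (lt_of_le_of_lt (le_add_of_nonneg_left (exp_pos _).le) hlt)
  change _ ≤ Y i g ∧ Y i g ≤ _
  constructor <;> linarith

lemma exists_projection {ι : Type*} (T : Finset ι) (x : ι → E)
    (m : ℕ) (hm : 2 * T.card * exp (-m) < 1) :
    ∃ g : Fin m → E, ∀ i ∈ T,
      m / 40 * ‖x i‖ ^ 2 ≤ ∑ j, ⟪x i, g j⟫ ^ 2 ∧ ∑ j, ⟪x i, g j⟫ ^ 2 ≤ 8 * m * ‖x i‖ ^ 2 := by
  classical
  let T' := T.filter fun i => x i ≠ 0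
  have hcard : (T'.card : ℝ) ≤ T.card := by exact_mod_cast Finset.card_filter_le _ _
  obtain ⟨g, hg⟩ := exists_projection_of_norm_eq_one T' (fun i => ‖x i‖⁻¹ • x i)
    (fun i hi => norm_smul_inv_norm (𝕜 := ℝ) (Finset.mem_filter.1 hi).2) m
    (lt_of_le_of_lt (by gcongr) hm)
  refine ⟨g, fun i hi => ?_⟩
  by_cases h0 : x i = 0
  · simp [h0]
  have hn : 0 < ‖x i‖ := norm_pos_iff.2 h0
  have h := hg i (Finset.mem_filter.2 ⟨hi, h0⟩)
  simp_rw [real_inner_smul_left, mul_pow, ← Finset.mul_sum, inv_pow] at h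
  rwa [le_inv_mul_iff₀ (by positivity), inv_mul_le_iff₀ (by positivity),
    mul_comm (‖x i‖ ^ 2), mul_comm (‖x i‖ ^ 2)] at h

end Projection

/-- A Johnson–Lindenstrauss lemma with constant distortion. -/
lemma exists_linear_embedding {E : Type*} [NormedAddCommGroup E] [InnerProductSpace ℝ E]
    (K : Finset E) (m : ℕ) (hm : 2 * (K.card : ℝ) ^ 2 * exp (-m) < 1) :
    ∃ g : Fin m → E, ∀ v ∈ K, ∀ w ∈ K,
      m / 40 * ‖v - w‖ ^ 2 ≤ ∑ j, ⟪v - w, g j⟫ ^ 2 ∧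
      ∑ j, ⟪v - w, g j⟫ ^ 2 ≤ 8 * m * ‖v - w‖ ^ 2 := by
  let S := Submodule.span ℝ (K : Set E)
  have : FiniteDimensional ℝ S := FiniteDimensional.span_finset ℝ K
  let _ : MeasurableSpace S := borel S
  have : BorelSpace S := ⟨rfl⟩
  obtain ⟨g, hg⟩ := exists_projection ((Finset.univ : Finset K) ×ˢ (Finset.univ : Finset K))
    (fun p => (⟨p.1, Submodule.subset_span p.1.2⟩ - ⟨p.2, Submodule.subset_span p.2.2⟩ : S)) m
    (by simpa [Finset.card_product, sq] using hm)
  exact ⟨fun j => g j, fun v hv w hw => hg (⟨v, hv⟩, ⟨w, hw⟩) (by simp)⟩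

end Gaussian

lemma sq_lpNorm_two {m : ℕ} (x : Fin m → ℝ) : lpNorm 2 x ^ 2 = ∑ i, x i ^ 2 := by
  rw [lpNorm, ← Real.sqrt_eq_rpow, Real.sq_sqrt]
  · exact Finset.sum_congr rfl fun i _ => by rw [Real.rpow_two, sq_abs]
  · exact Finset.sum_nonneg fun i _ => by positivity

lemma lpNorm_nonneg {m : ℕ} (p : ℝ) (x : Fin m → ℝ) : 0 ≤ lpNorm p x := by
  unfold lpNorm
  positivity

/-- Terminal Johnson–Lindenstrauss: every finite subset `X` of a real inner product space
with a set `K ⊆ X` of `k ≥ 2` terminals embeds into `ℓ₂^{O(log k)}` with terminal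
distortion `O(1)`. -/
theorem terminal_JL :
    ∃ C : ℝ, 0 < C ∧
      ∀ (E : Type) [NormedAddCommGroup E] [InnerProductSpace ℝ E]
        (X K : Finset E), K ⊆ X → 2 ≤ K.card →
        ∃ (m : ℕ) (F : E → Fin m → ℝ) (c : ℝ),
          (m : ℝ) ≤ C * Real.log K.card ∧ 0 < c ∧
          ∀ v ∈ K, ∀ u ∈ X,
            ‖v - u‖ ≤ c * lpNorm 2 (F v - F u) ∧
            c * lpNorm 2 (F v - F u) ≤ C * ‖v - u‖ := by
  refine ⟨54, by norm_num, fun E _ _ X K _ hK => ?_⟩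
  have hk : (2 : ℝ) ≤ K.card := by exact_mod_cast hK
  have hlog : 0.69 ≤ Real.log K.card :=
    le_trans (by linarith [Real.log_two_gt_d9]) (Real.log_le_log (by norm_num) hk)
  set m := ⌈4 * Real.log K.card⌉₊
  have hm1 : 4 * Real.log K.card ≤ m := Nat.le_ceil _
  have hm2 : (m : ℝ) < 4 * Real.log K.card + 1 := Nat.ceil_lt_add_one (by linarith)
  have hm0 : (0 : ℝ) < m := by linarith
  have hexp : 2 * (K.card : ℝ) ^ 2 * exp (-m) < 1 := by
    have h4 : (K.card : ℝ) ^ 4 ≤ exp m := by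
      calc (K.card : ℝ) ^ 4 = exp (Real.log K.card) ^ 4 := by rw [Real.exp_log (by linarith)]
        _ = exp (4 * Real.log K.card) := by rw [← exp_nat_mul]; norm_cast
        _ ≤ exp m := exp_le_exp.2 hm1
    rw [exp_neg, ← div_eq_mul_inv, div_lt_one (exp_pos _)]
    nlinarith [pow_le_pow_left₀ zero_le_two hk 2]
  obtain ⟨g, hg⟩ := exists_linear_embedding K m hexp
  have hne : K.Nonempty := Finset.card_pos.1 (by omega)
  choose n hnK hn using fun u : E => K.exists_min_image (fun w => ‖u - w‖) hne
  let F : E → Fin (m + 1) → ℝ := fun u =>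
    Fin.snoc (α := fun _ => ℝ) (fun j => ⟪n u, g j⟫ / √m) ‖u - n u‖
  refine ⟨m + 1, F, 9,
    by push_cast; linarith, by norm_num, fun v hv u _ => ?_⟩
  have hnv : n v = v := by
    have := hn v v hv
    simp only [sub_self, norm_zero] at this
    exact (sub_eq_zero.1 (norm_le_zero_iff.1 this)).symm
  set N := lpNorm 2 (F v - F u) with hN
  have hN0 : 0 ≤ N := lpNorm_nonneg _ _
  have hNsq : m * N ^ 2 = ∑ j, ⟪v - n u, g j⟫ ^ 2 + m * ‖u - n u‖ ^ 2 := by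
    rw [hN, sq_lpNorm_two, Fin.sum_univ_castSucc]
    simp only [F, Pi.sub_apply, Fin.snoc_castSucc, Fin.snoc_last, hnv, sub_self, norm_zero, zero_sub,
      neg_sq, ← sub_div, ← inner_sub_left, div_pow, Real.sq_sqrt hm0.le, ← Finset.sum_div]
    field_simp
  obtain ⟨hlow, hupp⟩ := hg v hv (n u) (hnK u)
  have hd : ‖u - n u‖ ≤ ‖v - u‖ := (hn u v hv).trans_eq (norm_sub_rev _ _)
  have hr : ‖v - u‖ ≤ ‖v - n u‖ + ‖u - n u‖ := by
    simpa [norm_sub_rev (n u) u] using norm_sub_le_norm_sub_add_norm_sub v (n u) u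
  have hD : ‖v - n u‖ ≤ ‖v - u‖ + ‖u - n u‖ := norm_sub_le_norm_sub_add_norm_sub v u (n u)
  set D := ‖v - n u‖
  set d := ‖u - n u‖
  set r := ‖v - u‖
  have hd0 : 0 ≤ d := norm_nonneg _
  have hD0 : 0 ≤ D := norm_nonneg _
  have hr0 : 0 ≤ r := norm_nonneg _
  have low : D ^ 2 / 40 + d ^ 2 ≤ N ^ 2 := by
    refine le_of_mul_le_mul_left ?_ hm0
    linarith
  have upp : N ^ 2 ≤ 8 * D ^ 2 + d ^ 2 := by
    refine le_of_mul_le_mul_left ?_ hm0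
    linarith
  constructor
  · refine abs_le_of_sq_le_sq' ?_ (by positivity) |>.2
    have : r ^ 2 ≤ (D + d) ^ 2 := by gcongr
    nlinarith [sq_nonneg (D - d)]
  · refine abs_le_of_sq_le_sq' ?_ (by positivity) |>.2
    have h1 : D ^ 2 ≤ (2 * r) ^ 2 := by
      gcongr
      linarith
    have h2 : d ^ 2 ≤ r ^ 2 := by gcongr
    nlinarith
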